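/- Let M be a cancellative monoid and let K, H be finite subgroups of M. Then there exist finitely many subgroups K₁, …, K_s of H such that [M/K, M/H] = ⋃_{i=1}^s Ω_i, where Ω_i := {mH | m ∈ M, Km = mK_i}; each set Ω_i is invariant under the action of W_MK; and for all i, j the sets Ω_i and Ω_j are either disjoint or equal. -/

import Mathlib

/-- `mulLeft m S = mS = {m*s | s ∈ S}`. -/
def mulLeft {M : Type*} [Monoid M] (m : M) (S : Set M) : Set M := (m * ·) '' S

/-- `mulRight S m = Sm = {s*m | s ∈ S}`. -/
def mulRight {M : Type*} [Monoid M] (S : Set M) (m : M) : Set M := (· * m) '' S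

/-- A subset of a monoid which is a subgroup: it contains `1`, is closed under
multiplication, and every element has a (two-sided) inverse inside the set. -/
def IsSubgroupSet {M : Type*} [Monoid M] (S : Set M) : Prop :=
  (1 : M) ∈ S ∧ (∀ a ∈ S, ∀ b ∈ S, a * b ∈ S) ∧ (∀ a ∈ S, ∃ b ∈ S, a * b = 1 ∧ b * a = 1)

/-- A finite subgroup of a monoid. -/
def IsFiniteSubgroup {M : Type*} [Monoid M] (S : Set M) : Prop :=
  IsSubgroupSet S ∧ S.Finite

/-- `[M/K, M/H] = {mH | Km ⊆ mH}`. -/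
def morSet {M : Type*} [Monoid M] (K H : Set M) : Set (Set M) :=
  {X | ∃ m : M, X = mulLeft m H ∧ mulRight K m ⊆ mulLeft m H}

/-- Representatives of elements of the Weyl monoid `W_MK = {xK | Kx = xK}`. -/
def weyl {M : Type*} [Monoid M] (K : Set M) : Set M :=
  {x | mulRight K x = mulLeft x K}

/-- `Ω_{K'} = {mH | Km = mK'}`. -/
def OmegaSet {M : Type*} [Monoid M] (K H K' : Set M) : Set (Set M) :=
  {X | ∃ m : M, X = mulLeft m H ∧ mulRight K m = mulLeft m K'}

theorem ll_aux {M : Type*} [Monoid M] (a b : M) (S : Set M) :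
    mulLeft a (mulLeft b S) = mulLeft (a * b) S := by
  simp only [mulLeft, Set.image_image, mul_assoc]

theorem rr_aux {M : Type*} [Monoid M] (a b : M) (S : Set M) :
    mulRight (mulRight S a) b = mulRight S (a * b) := by
  simp only [mulRight, Set.image_image, mul_assoc]

theorem lr_aux {M : Type*} [Monoid M] (a b : M) (S : Set M) :
    mulRight (mulLeft a S) b = mulLeft a (mulRight S b) := by
  simp only [mulRight, mulLeft, Set.image_image, mul_assoc]

theorem linj_aux {M : Type*} [CancelMonoid M] (a : M) {S T : Set M}
    (h : mulLeft a S = mulLeft a T) : S = T :=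
  Set.image_injective.mpr (mul_right_injective a) h

theorem absorb_aux {M : Type*} [Monoid M] {H : Set M} (hH : IsSubgroupSet H) {h : M}
    (hh : h ∈ H) : mulLeft h H = H := by
  obtain ⟨_, hm, hi⟩ := hH
  obtain ⟨g, hg, h1, _⟩ := hi h hh
  ext y
  constructor
  · rintro ⟨z, hz, rfl⟩
    exact hm h hh z hz
  · intro hy
    exact ⟨g * y, hm g hg y hy, by simp [← mul_assoc, h1]⟩

theorem omega_sub_aux {M : Type*} [CancelMonoid M] {K H K1 K2 : Set M}
    (hH : IsSubgroupSet H) {X : Set M} (h1 : X ∈ OmegaSet K H K1) (h2 : X ∈ OmegaSet K H K2) :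
    OmegaSet K H K1 ⊆ OmegaSet K H K2 := by
  obtain ⟨m, hX, hm⟩ := h1
  obtain ⟨n, hX', hn⟩ := h2
  have hnX : n ∈ mulLeft m H := by
    rw [← hX, hX']
    exact ⟨1, hH.1, by simp⟩
  obtain ⟨h, hh, e⟩ := hnX
  simp only at e
  subst e
  have key : mulRight K1 h = mulLeft h K2 := by
    apply linj_aux m
    rw [← lr_aux, ← hm, rr_aux, hn, ll_aux]
  rintro Y ⟨p, rfl, hp⟩
  refine ⟨p * h, ?_, ?_⟩
  · rw [← ll_aux, absorb_aux hH hh]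
  · rw [← rr_aux, hp, lr_aux, key, ll_aux]

theorem stab_aux {M : Type*} [CancelMonoid M] {K H : Set M}
    (hK : IsSubgroupSet K) (hH : IsSubgroupSet H) (m : M) :
    IsSubgroupSet {h | h ∈ H ∧ m * h ∈ mulRight K m} := by
  refine ⟨⟨hH.1, 1, hK.1, by simp⟩, ?_, ?_⟩
  · rintro a ⟨ha, k, hk, e⟩ b ⟨hb, l, hl, f⟩
    refine ⟨hH.2.1 a ha b hb, k * l, hK.2.1 k hk l hl, ?_⟩
    simp only at e f ⊢
    rw [mul_assoc, f, ← mul_assoc, e, mul_assoc]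
  · rintro a ⟨ha, k, hk, e⟩
    obtain ⟨b, hb, h1, h2⟩ := hH.2.2 a ha
    obtain ⟨l, hl, g1, g2⟩ := hK.2.2 k hk
    refine ⟨b, ⟨hb, l, hl, ?_⟩, h1, h2⟩
    simp only at e ⊢
    apply mul_left_cancel (a := k)
    rw [← mul_assoc, g1, ← mul_assoc, e, mul_assoc, h1, one_mul, mul_one]

/-- decomposition of `[M/K, M/H]` into `W_MK`-invariant pieces
`Ω_i = {mH | Km = mK_i}` for finitely many subgroups `K₁, …, K_s ≤ H`,
any two of which are disjoint or equal. -/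
theorem stmt1 {M : Type*} [CancelMonoid M] (K H : Set M)
    (hK : IsFiniteSubgroup K) (hH : IsFiniteSubgroup H) :
    ∃ (s : ℕ) (Ks : Fin s → Set M),
      (∀ i, Ks i ⊆ H ∧ IsSubgroupSet (Ks i)) ∧
      morSet K H = ⋃ i, OmegaSet K H (Ks i) ∧
      (∀ i, ∀ x ∈ weyl K, ∀ X ∈ OmegaSet K H (Ks i), mulLeft x X ∈ OmegaSet K H (Ks i)) ∧
      (∀ i j, OmegaSet K H (Ks i) = OmegaSet K H (Ks j) ∨
        Disjoint (OmegaSet K H (Ks i)) (OmegaSet K H (Ks j))) := by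
  classical
  have hfin : {S : Set M | S ⊆ H ∧ IsSubgroupSet S}.Finite :=
    hH.2.finite_subsets.subset fun S hS => hS.1
  obtain ⟨s, Ks, -, hKs⟩ := hfin.fin_param
  have hmem : ∀ i, Ks i ⊆ H ∧ IsSubgroupSet (Ks i) := by
    intro i
    have : Ks i ∈ Set.range Ks := ⟨i, rfl⟩
    rw [hKs] at this
    exact this
  refine ⟨s, Ks, hmem, ?_, ?_, ?_⟩
  · ext X
    simp only [Set.mem_iUnion]
    constructor
    · rintro ⟨m, rfl, hm⟩
      have : {h | h ∈ H ∧ m * h ∈ mulRight K m} ∈ Set.range Ks := by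
        rw [hKs]
        exact ⟨fun h hh => hh.1, stab_aux hK.1 hH.1 m⟩
      obtain ⟨i, hi⟩ := this
      refine ⟨i, m, rfl, ?_⟩
      rw [hi]
      apply Set.Subset.antisymm
      · intro y hy
        obtain ⟨h, hh, rfl⟩ := hm hy
        exact ⟨h, ⟨hh, hy⟩, rfl⟩
      · rintro y ⟨h, hh, rfl⟩
        exact hh.2
    · rintro ⟨i, m, rfl, hm⟩
      refine ⟨m, rfl, ?_⟩
      rw [hm]
      exact Set.image_mono (hmem i).1
  · rintro i x hx X ⟨m, rfl, hm⟩
    have hx' : mulRight K x = mulLeft x K := hx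
    refine ⟨x * m, ll_aux _ _ _, ?_⟩
    rw [← rr_aux, hx', lr_aux, hm, ll_aux]
  · intro i j
    by_cases hd : Disjoint (OmegaSet K H (Ks i)) (OmegaSet K H (Ks j))
    · exact Or.inr hd
    · obtain ⟨X, h1, h2⟩ := Set.not_disjoint_iff.mp hd
      exact Or.inl (Set.Subset.antisymm (omega_sub_aux hH.1 h1 h2) (omega_sub_aux hH.1 h2 h1))
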